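/- Let 0 < R < r, let ψ ∈ [0, π], and let P₂(z) = (3z² − 1)/2. For δ in a neighbourhood of 0 define F(δ) = ∫₀^π ∫₀^{2π} ∫₀^{R(1 + δ·P₂(cos α))} s²·sin α · (r² + s² − 2·r·s·(cos ψ·cos α + sin ψ·sin α·cos φ))^{−1/2} ds dφ dα. Then F(0) = 4πR³/(3r), and F is differentiable at δ = 0 with F'(0) = (4π/5)·(R⁵/r³)·P₂(cos ψ). Consequently, the gravitational potential at an exterior point (r, ψ) of a homogeneous body of mass M bounded by the surface s = R(1 + δ·P₂(cos α)) is V_S = −κM·(1/r + (3/5)·(R²/r³)·δ·P₂(cos ψ)) + o(δ). -/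

import Mathlib

open Asymptotics Filter

section SphereIntegrals

open MeasureTheory Real

lemma intervalIntegral_swap_of_continuous {f : ℝ × ℝ → ℝ} (hf : Continuous f) (a b c d : ℝ) :
    ∫ x in a..b, ∫ y in c..d, f (x, y) = ∫ y in c..d, ∫ x in a..b, f (x, y) := by
  refine intervalIntegral_intervalIntegral_swap (F := fun x y => f (x, y)) ?_
  exact (hf.continuousOn.integrableOn_compact (isCompact_uIcc.prod isCompact_uIcc)).mono_set
    (Set.prod_mono Set.uIoc_subset_uIcc Set.uIoc_subset_uIcc)

lemma intervalIntegral_rotate_of_continuous {f : ℝ × ℝ × ℝ → ℝ} (hf : Continuous f)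
    (a b c d u v : ℝ) :
    ∫ x in a..b, ∫ y in c..d, ∫ z in u..v, f (x, y, z) =
      ∫ z in u..v, ∫ x in a..b, ∫ y in c..d, f (x, y, z) := by
  have h (x : ℝ) : ∫ y in c..d, ∫ z in u..v, f (x, y, z) =
      ∫ z in u..v, ∫ y in c..d, f (x, y, z) :=
    intervalIntegral_swap_of_continuous (f := fun w => f (x, w.1, w.2)) (by fun_prop) ..
  simp_rw [h]
  exact intervalIntegral_swap_of_continuous
    (f := fun w => ∫ y in c..d, f (w.1, y, w.2)) (by fun_prop) ..

/-- The generator of rotations about the `y`-axis integrates to zero over the sphere. -/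
lemma sphere_integral_rotation_generator {Φ Φa Φp : ℝ × ℝ → ℝ}
    (hΦ : Continuous Φ) (hΦa : Continuous Φa) (hΦp : Continuous Φp)
    (da : ∀ a p, HasDerivAt (fun a => Φ (a, p)) (Φa (a, p)) a)
    (dp : ∀ a p, HasDerivAt (fun p => Φ (a, p)) (Φp (a, p)) p) :
    ∫ a in (0 : ℝ)..π, ∫ p in (0 : ℝ)..(2 * π),
      (-(sin a * cos p * Φa (a, p)) + cos a * sin p * Φp (a, p)) = 0 := by
  have hA : ∫ a in (0 : ℝ)..π, ∫ p in (0 : ℝ)..(2 * π),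
      (-(cos a * cos p * Φ (a, p) + sin a * cos p * Φa (a, p))) = 0 := by
    rw [intervalIntegral_swap_of_continuous
      (f := fun w => -(cos w.1 * cos w.2 * Φ (w.1, w.2) + sin w.1 * cos w.2 * Φa (w.1, w.2)))
      (by fun_prop)]
    refine (intervalIntegral.integral_congr (g := fun _ => 0) fun p _ => ?_).trans (by simp)
    beta_reduce
    rw [intervalIntegral.integral_eq_sub_of_hasDerivAt
      (f := fun a => -(sin a * cos p * Φ (a, p)))
      (fun a _ => (((hasDerivAt_sin a).mul_const _).mul (da a p)).neg)
      (Continuous.intervalIntegrable (by fun_prop) _ _)]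
    simp
  have hB : ∫ a in (0 : ℝ)..π, ∫ p in (0 : ℝ)..(2 * π),
      (cos a * cos p * Φ (a, p) + cos a * sin p * Φp (a, p)) = 0 := by
    refine (intervalIntegral.integral_congr (g := fun _ => 0) fun a _ => ?_).trans (by simp)
    beta_reduce
    rw [intervalIntegral.integral_eq_sub_of_hasDerivAt
      (f := fun p => cos a * sin p * Φ (a, p))
      (f' := fun p => cos a * cos p * Φ (a, p) + cos a * sin p * Φp (a, p))
      (fun p _ => ((hasDerivAt_sin p).const_mul _).mul (dp a p))
      (Continuous.intervalIntegrable (by fun_prop) _ _)]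
    simp
  rw [intervalIntegral.integral_congr (g := fun a =>
      (∫ p in (0 : ℝ)..(2 * π), (-(cos a * cos p * Φ (a, p) + sin a * cos p * Φa (a, p)))) +
      ∫ p in (0 : ℝ)..(2 * π), (cos a * cos p * Φ (a, p) + cos a * sin p * Φp (a, p))),
    intervalIntegral.integral_add (Continuous.intervalIntegrable (by fun_prop) _ _)
      (Continuous.intervalIntegrable (by fun_prop) _ _), hA, hB, add_zero]
  intro a _
  beta_reduce
  rw [← intervalIntegral.integral_add (Continuous.intervalIntegrable (by fun_prop) _ _)
    (Continuous.intervalIntegrable (by fun_prop) _ _)]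
  refine intervalIntegral.integral_congr fun p _ => ?_
  ring

/-- The integral over the sphere of a family of functions transported by rotations about the
`y`-axis does not depend on the angle. -/
lemma sphere_integral_rotation_invariant {Φ Φt Φa Φp : ℝ × ℝ × ℝ → ℝ}
    (hΦ : Continuous Φ) (hΦt : Continuous Φt) (hΦa : Continuous Φa) (hΦp : Continuous Φp)
    (dt : ∀ t a p, HasDerivAt (fun t => Φ (t, a, p)) (Φt (t, a, p)) t)
    (da : ∀ t a p, HasDerivAt (fun a => Φ (t, a, p)) (Φa (t, a, p)) a)
    (dp : ∀ t a p, HasDerivAt (fun p => Φ (t, a, p)) (Φp (t, a, p)) p)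
    (h : ∀ t a p, sin a * Φt (t, a, p) =
      -(sin a * cos p * Φa (t, a, p)) + cos a * sin p * Φp (t, a, p)) (t₀ t₁ : ℝ) :
    ∫ a in (0 : ℝ)..π, ∫ p in (0 : ℝ)..(2 * π), sin a * Φ (t₁, a, p) =
      ∫ a in (0 : ℝ)..π, ∫ p in (0 : ℝ)..(2 * π), sin a * Φ (t₀, a, p) := by
  rw [← sub_eq_zero, ← intervalIntegral.integral_sub
    (Continuous.intervalIntegrable (by fun_prop) _ _)
    (Continuous.intervalIntegrable (by fun_prop) _ _)]
  calc _ = ∫ a in (0 : ℝ)..π, ∫ p in (0 : ℝ)..(2 * π), ∫ t in t₀..t₁, sin a * Φt (t, a, p) := by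
        refine intervalIntegral.integral_congr fun a _ => ?_
        rw [← intervalIntegral.integral_sub (Continuous.intervalIntegrable (by fun_prop) _ _)
          (Continuous.intervalIntegrable (by fun_prop) _ _)]
        refine intervalIntegral.integral_congr fun p _ => ?_
        rw [intervalIntegral.integral_eq_sub_of_hasDerivAt
          (f := fun t => sin a * Φ (t, a, p)) (fun t _ => (dt t a p).const_mul _)
          (Continuous.intervalIntegrable (by fun_prop) _ _)]
    _ = ∫ t in t₀..t₁, ∫ a in (0 : ℝ)..π, ∫ p in (0 : ℝ)..(2 * π), sin a * Φt (t, a, p) :=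
        intervalIntegral_rotate_of_continuous
          (f := fun w => sin w.1 * Φt (w.2.2, w.1, w.2.1)) (by fun_prop) ..
    _ = ∫ t in t₀..t₁, 0 := by
        refine intervalIntegral.integral_congr fun t _ => ?_
        simp only [h]
        exact sphere_integral_rotation_generator (Φ := fun w => Φ (t, w))
          (Φa := fun w => Φa (t, w)) (Φp := fun w => Φp (t, w)) (by fun_prop) (by fun_prop)
          (by fun_prop) (da t) (dp t)
    _ = 0 := by simp

lemma cos_mul_cos_add_mem_Icc (t a p : ℝ) :
    cos t * cos a + sin t * sin a * cos p ∈ Set.Icc (-1 : ℝ) 1 := by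
  have h1 := sin_sq_add_cos_sq t
  have h2 := sin_sq_add_cos_sq a
  have h3 := sin_sq_add_cos_sq p
  have e : 1 - (cos t * cos a + sin t * sin a * cos p) ^ 2 =
      (sin t * cos a - cos t * sin a * cos p) ^ 2 + (sin a * sin p) ^ 2 := by
    linear_combination (-cos a ^ 2 - sin a ^ 2 * cos p ^ 2) * h1 - h2 - sin a ^ 2 * h3
  have : (cos t * cos a + sin t * sin a * cos p) ^ 2 ≤ 1 := by
    linarith [sq_nonneg (sin t * cos a - cos t * sin a * cos p), sq_nonneg (sin a * sin p)]
  exact ⟨by nlinarith, by nlinarith⟩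

/-- Zonal case of the Funk-Hecke formula, in degrees zero and two. -/
lemma sphere_integral_legendre_two_mul {h h' : ℝ → ℝ}
    (dh : ∀ x ∈ Set.Icc (-1 : ℝ) 1, HasDerivAt h (h' x) x)
    (hh' : ContinuousOn h' (Set.Icc (-1) 1)) (c d ψ : ℝ) :
    ∫ a in (0 : ℝ)..π, ∫ p in (0 : ℝ)..(2 * π),
        sin a * ((c + d * ((3 * cos a ^ 2 - 1) / 2)) *
          h (cos ψ * cos a + sin ψ * sin a * cos p)) =
      2 * π * ∫ a in (0 : ℝ)..π, sin a *
        ((c + d * ((3 * cos ψ ^ 2 - 1) / 2) * ((3 * cos a ^ 2 - 1) / 2)) * h (cos a)) := by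
  have hh : ContinuousOn h (Set.Icc (-1) 1) := HasDerivAt.continuousOn dh
  have bound := cos_mul_cos_add_mem_Icc
  obtain ⟨H, hH, hHe⟩ : ∃ H : ℝ × ℝ × ℝ → ℝ, Continuous H ∧ ∀ t a p, H (t, a, p) =
      h (cos (ψ + t) * cos a + sin (ψ + t) * sin a * cos p) :=
    ⟨_, hh.comp_continuous (f := fun w : ℝ × ℝ × ℝ => cos (ψ + w.1) * cos w.2.1 +
      sin (ψ + w.1) * sin w.2.1 * cos w.2.2) (by fun_prop) fun w => bound _ _ _,
      fun _ _ _ => rfl⟩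
  obtain ⟨H', hH', hHe'⟩ : ∃ H : ℝ × ℝ × ℝ → ℝ, Continuous H ∧ ∀ t a p, H (t, a, p) =
      h' (cos (ψ + t) * cos a + sin (ψ + t) * sin a * cos p) :=
    ⟨_, hh'.comp_continuous (f := fun w : ℝ × ℝ × ℝ => cos (ψ + w.1) * cos w.2.1 +
      sin (ψ + w.1) * sin w.2.1 * cos w.2.2) (by fun_prop) fun w => bound _ _ _,
      fun _ _ _ => rfl⟩
  have Xt (t a p : ℝ) : HasDerivAt (fun t => cos t * cos a + sin t * sin a * cos p)
      (-sin t * cos a + cos t * sin a * cos p) t :=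
    ((hasDerivAt_cos t).mul_const _).add (((hasDerivAt_sin t).mul_const _).mul_const _)
  have Xa (t a p : ℝ) : HasDerivAt (fun a => cos t * cos a + sin t * sin a * cos p)
      (cos t * -sin a + sin t * cos a * cos p) a :=
    ((hasDerivAt_cos a).const_mul _).add (((hasDerivAt_sin a).const_mul _).mul_const _)
  have Xp (t a p : ℝ) : HasDerivAt (fun p => cos t * cos a + sin t * sin a * cos p)
      (sin t * sin a * -sin p) p :=
    ((hasDerivAt_cos p).const_mul _).const_add _
  have dg {f k : ℝ → ℝ} {f' k' x : ℝ} (hf : HasDerivAt f f' x) (hk : HasDerivAt k k' x)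
      (hx : k x ∈ Set.Icc (-1 : ℝ) 1) :
      HasDerivAt (fun x => (c + d * ((3 * f x ^ 2 - 1) / 2)) * h (k x))
        (d * (3 * f x * f') * h (k x) + (c + d * ((3 * f x ^ 2 - 1) / 2)) * (h' (k x) * k'))
        x := by
    refine HasDerivAt.mul ?_ ((dh _ hx).comp x hk)
    refine ((((((hf.pow 2).const_mul 3).sub_const 1).div_const 2).const_mul d).const_add
      c).congr_deriv ?_
    push_cast
    ring
  have key := sphere_integral_rotation_invariant
    (Φ := fun w => (c + d * ((3 * (cos w.1 * cos w.2.1 + sin w.1 * sin w.2.1 * cos w.2.2) ^ 2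
        - 1) / 2)) * H w)
    (Φt := fun w => d * (3 * (cos w.1 * cos w.2.1 + sin w.1 * sin w.2.1 * cos w.2.2) *
        (-sin w.1 * cos w.2.1 + cos w.1 * sin w.2.1 * cos w.2.2)) * H w +
      (c + d * ((3 * (cos w.1 * cos w.2.1 + sin w.1 * sin w.2.1 * cos w.2.2) ^ 2 - 1) / 2)) *
      (H' w * (-sin (ψ + w.1) * cos w.2.1 + cos (ψ + w.1) * sin w.2.1 * cos w.2.2)))
    (Φa := fun w => d * (3 * (cos w.1 * cos w.2.1 + sin w.1 * sin w.2.1 * cos w.2.2) *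
        (cos w.1 * -sin w.2.1 + sin w.1 * cos w.2.1 * cos w.2.2)) * H w +
      (c + d * ((3 * (cos w.1 * cos w.2.1 + sin w.1 * sin w.2.1 * cos w.2.2) ^ 2 - 1) / 2)) *
      (H' w * (cos (ψ + w.1) * -sin w.2.1 + sin (ψ + w.1) * cos w.2.1 * cos w.2.2)))
    (Φp := fun w => d * (3 * (cos w.1 * cos w.2.1 + sin w.1 * sin w.2.1 * cos w.2.2) *
        (sin w.1 * sin w.2.1 * -sin w.2.2)) * H w +
      (c + d * ((3 * (cos w.1 * cos w.2.1 + sin w.1 * sin w.2.1 * cos w.2.2) ^ 2 - 1) / 2)) *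
      (H' w * (sin (ψ + w.1) * sin w.2.1 * -sin w.2.2)))
    (by fun_prop) (by fun_prop) (by fun_prop) (by fun_prop)
    (fun t a p => by
      simp only [hHe, hHe']
      exact dg (Xt t a p) ((Xt (ψ + t) a p).comp_const_add ψ t) (bound (ψ + t) a p))
    (fun t a p => by
      simp only [hHe, hHe']
      exact dg (Xa t a p) (Xa (ψ + t) a p) (bound (ψ + t) a p))
    (fun t a p => by
      simp only [hHe, hHe']
      exact dg (Xp t a p) (Xp (ψ + t) a p) (bound (ψ + t) a p))
    (fun t a p => by
      have h3 := sin_sq_add_cos_sq p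
      dsimp only
      generalize H (t, a, p) = y
      generalize H' (t, a, p) = z
      linear_combination (d * (3 * (cos t * cos a + sin t * sin a * cos p)) * y * sin t +
        (c + d * ((3 * (cos t * cos a + sin t * sin a * cos p) ^ 2 - 1) / 2)) * z *
          sin (ψ + t)) * sin a * cos a * h3) (-ψ) 0
  simp only [hHe, cos_zero, sin_zero, add_zero, one_mul, zero_mul, add_neg_cancel, cos_neg,
    sin_neg] at key
  rw [key, ← intervalIntegral.integral_const_mul]
  refine intervalIntegral.integral_congr fun a _ => ?_
  have hq : ∀ p ∈ Set.uIcc 0 (2 * π), HasDerivAt (fun p => sin a * ((c * p +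
      d * ((3 * ((cos ψ * cos a) ^ 2 * p - 2 * (cos ψ * cos a) * (sin ψ * sin a) * sin p +
        (sin ψ * sin a) ^ 2 * ((p + sin p * cos p) / 2)) - p) / 2)) * h (cos a)))
      (sin a * ((c + d * ((3 * (cos ψ * cos a + -sin ψ * sin a * cos p) ^ 2 - 1) / 2)) *
        h (cos a))) p := by
    intro p _
    have d1 := (hasDerivAt_id p).const_mul ((cos ψ * cos a) ^ 2)
    have d2 := (hasDerivAt_sin p).const_mul (2 * (cos ψ * cos a) * (sin ψ * sin a))
    have d3 := (((hasDerivAt_id p).add ((hasDerivAt_sin p).mul (hasDerivAt_cos p))).div_const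
      2).const_mul ((sin ψ * sin a) ^ 2)
    refine ((((((((d1.sub d2).add d3).const_mul 3).sub (hasDerivAt_id p)).div_const
      2).const_mul d).add ((hasDerivAt_id p).const_mul c)).mul_const (h (cos a))).const_mul
      (sin a) |>.congr_deriv ?_ |>.congr_of_eventuallyEq (.of_forall fun x => ?_)
    · linear_combination (-sin a * h (cos a) * d * 3 / 4 * (sin ψ * sin a) ^ 2) *
        sin_sq_add_cos_sq p
    · simp only [Pi.add_apply, Pi.sub_apply, Pi.mul_apply, id]
      ring
  rw [intervalIntegral.integral_eq_sub_of_hasDerivAt hq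
    (Continuous.intervalIntegrable (by fun_prop) _ _)]
  have h1 := sin_sq ψ
  have h2 := sin_sq a
  simp only [sin_two_pi, cos_two_pi, sin_zero, mul_pow, h1]
  linear_combination π * sin a * h (cos a) * d * 3 / 2 * (1 - cos ψ ^ 2) * h2

lemma sq_sub_le_sq_dist {r s x : ℝ} (hr : 0 ≤ r) (hs : 0 ≤ s) (hx : x ≤ 1) :
    (r - s) ^ 2 ≤ r ^ 2 + s ^ 2 - 2 * r * s * x := by
  nlinarith [mul_nonneg (mul_nonneg hr hs) (sub_nonneg.2 hx)]

lemma integral_sin_mul_legendre_two_mul_inv_dist {r s : ℝ} (hs : 0 < s) (hsr : s < r)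
    (c d : ℝ) :
    ∫ a in (0 : ℝ)..π, sin a * ((c + d * ((3 * cos a ^ 2 - 1) / 2)) *
        (√(r ^ 2 + s ^ 2 - 2 * r * s * cos a))⁻¹) =
      2 * c / r + d * (2 / 5) * (s ^ 2 / r ^ 3) := by
  have hr : 0 < r := hs.trans hsr
  have pos (a : ℝ) : 0 < r ^ 2 + s ^ 2 - 2 * r * s * cos a :=
    (sq_pos_of_pos (sub_pos.2 hsr)).trans_le (sq_sub_le_sq_dist hr.le hs.le (cos_le_one a))
  have hw (a : ℝ) : HasDerivAt (fun a => √(r ^ 2 + s ^ 2 - 2 * r * s * cos a))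
      (r * s * sin a / √(r ^ 2 + s ^ 2 - 2 * r * s * cos a)) a := by
    convert ((((hasDerivAt_cos a).const_mul (2 * r * s)).const_sub (r ^ 2 + s ^ 2)).sqrt
      (pos a).ne') using 1
    field_simp
  have hQ (a : ℝ) : HasDerivAt (fun a =>
      (c * √(r ^ 2 + s ^ 2 - 2 * r * s * cos a) +
        d * (3 / (8 * r ^ 2 * s ^ 2) * (((r ^ 2 + s ^ 2) ^ 2 *
            √(r ^ 2 + s ^ 2 - 2 * r * s * cos a) -
          2 * (r ^ 2 + s ^ 2) / 3 * √(r ^ 2 + s ^ 2 - 2 * r * s * cos a) ^ 3) +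
          √(r ^ 2 + s ^ 2 - 2 * r * s * cos a) ^ 5 / 5) -
        √(r ^ 2 + s ^ 2 - 2 * r * s * cos a) / 2)) / (r * s))
      (sin a * ((c + d * ((3 * cos a ^ 2 - 1) / 2)) *
        (√(r ^ 2 + s ^ 2 - 2 * r * s * cos a))⁻¹)) a := by
    have h3 := ((hw a).pow 3).const_mul (2 * (r ^ 2 + s ^ 2) / 3)
    have h5 := ((hw a).pow 5).div_const 5
    refine (((((hw a).const_mul c).add ((((((hw a).const_mul ((r ^ 2 + s ^ 2) ^ 2)).sub
      h3).add h5).const_mul (3 / (8 * r ^ 2 * s ^ 2))).sub ((hw a).div_const 2)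
      |>.const_mul d)).div_const (r * s))).congr_deriv ?_
    have hpos := sqrt_pos.2 (pos a)
    have hsq := sq_sqrt (pos a).le
    have hcos : cos a = (r ^ 2 + s ^ 2 - √(r ^ 2 + s ^ 2 - 2 * r * s * cos a) ^ 2) /
        (2 * r * s) := by
      rw [hsq]; field_simp; ring
    generalize √(r ^ 2 + s ^ 2 - 2 * r * s * cos a) = w at *
    rw [hcos]
    push_cast
    field_simp
    ring
  have hcont : Continuous fun a => sin a * ((c + d * ((3 * cos a ^ 2 - 1) / 2)) *
        (√(r ^ 2 + s ^ 2 - 2 * r * s * cos a))⁻¹) := by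
    have := fun a => (sqrt_pos.2 (pos a)).ne'
    fun_prop (disch := assumption)
  rw [intervalIntegral.integral_eq_sub_of_hasDerivAt (fun a _ => hQ a)
    (hcont.intervalIntegrable _ _)]
  have e1 : √(r ^ 2 + s ^ 2 - 2 * r * s * cos π) = r + s := by
    rw [cos_pi, ← sqrt_sq (by positivity : 0 ≤ r + s)]; ring_nf
  have e0 : √(r ^ 2 + s ^ 2 - 2 * r * s * cos 0) = r - s := by
    rw [cos_zero, ← sqrt_sq (sub_pos.2 hsr).le]; ring_nf
  rw [e1, e0]
  field_simp
  ring

lemma sphere_integral_legendre_two_mul_inv_dist {r s : ℝ} (hs : 0 < s) (hsr : s < r)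
    (c d ψ : ℝ) :
    ∫ a in (0 : ℝ)..π, ∫ p in (0 : ℝ)..(2 * π),
        sin a * ((c + d * ((3 * cos a ^ 2 - 1) / 2)) *
          (√(r ^ 2 + s ^ 2 - 2 * r * s * (cos ψ * cos a + sin ψ * sin a * cos p)))⁻¹) =
      4 * π * (c / r + d * ((3 * cos ψ ^ 2 - 1) / 2) * (s ^ 2 / (5 * r ^ 3))) := by
  have hr : 0 < r := hs.trans hsr
  have pos : ∀ x ∈ Set.Icc (-1 : ℝ) 1, 0 < r ^ 2 + s ^ 2 - 2 * r * s * x := fun x hx =>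
    (sq_pos_of_pos (sub_pos.2 hsr)).trans_le (sq_sub_le_sq_dist hr.le hs.le hx.2)
  rw [sphere_integral_legendre_two_mul (h := fun x => (√(r ^ 2 + s ^ 2 - 2 * r * s * x))⁻¹)
    (h' := fun x => -(-(2 * r * s * 1) / (2 * √(r ^ 2 + s ^ 2 - 2 * r * s * x))) /
      √(r ^ 2 + s ^ 2 - 2 * r * s * x) ^ 2)
    (fun x hx => ((((hasDerivAt_id x).const_mul (2 * r * s)).const_sub (r ^ 2 + s ^ 2)).sqrt
      (pos x hx).ne').fun_inv (sqrt_pos.2 (pos x hx)).ne'),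
    integral_sin_mul_legendre_two_mul_inv_dist hs hsr]
  · field_simp
    ring
  · have := fun x hx => (sqrt_pos.2 (pos x hx)).ne'
    have h2 : ∀ x ∈ Set.Icc (-1 : ℝ) 1, 2 * √(r ^ 2 + s ^ 2 - 2 * r * s * x) ≠ 0 :=
      fun x hx => mul_ne_zero two_ne_zero (this x hx)
    have h3 : ∀ x ∈ Set.Icc (-1 : ℝ) 1, √(r ^ 2 + s ^ 2 - 2 * r * s * x) ^ 2 ≠ 0 :=
      fun x hx => pow_ne_zero 2 (this x hx)
    fun_prop (disch := assumption)

lemma hasDerivAt_integral_radial {k : ℝ × ℝ × ℝ → ℝ} (hk : Continuous k) {u : ℝ → ℝ}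
    (hu : Continuous u) (R a b c d : ℝ) :
    HasDerivAt (fun δ => ∫ x in a..b, ∫ y in c..d, ∫ s in 0..(R * (1 + δ * u x)), k (x, y, s))
      (∫ x in a..b, ∫ y in c..d, R * u x * k (x, y, R)) 0 := by
  set G : ℝ → ℝ := fun δ => ∫ x in a..b, ∫ y in c..d, ∫ t in (0 : ℝ)..1,
    R * u x * k (x, y, R + R * δ * u x * t) with hG
  have hGc : Continuous G := by fun_prop
  have hG0 : G 0 = ∫ x in a..b, ∫ y in c..d, R * u x * k (x, y, R) := by simp [hG]
  have hF (δ : ℝ) : ∫ x in a..b, ∫ y in c..d, ∫ s in 0..(R * (1 + δ * u x)), k (x, y, s) =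
      (∫ x in a..b, ∫ y in c..d, ∫ s in 0..R, k (x, y, s)) + δ * G δ := by
    have inner (x y : ℝ) : ∫ s in 0..(R * (1 + δ * u x)), k (x, y, s) =
        (∫ s in 0..R, k (x, y, s)) +
          δ * ∫ t in (0 : ℝ)..1, R * u x * k (x, y, R + R * δ * u x * t) := by
      have h := intervalIntegral.mul_integral_comp_add_mul (f := fun s => k (x, y, s))
        (c := R * δ * u x) (d := R) (a := 0) (b := 1)
      rw [mul_zero, add_zero, mul_one] at h
      rw [intervalIntegral.integral_const_mul, ← mul_assoc, ← mul_assoc, mul_comm δ R, h,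
        intervalIntegral.integral_add_adjacent_intervals
          (Continuous.intervalIntegrable (by fun_prop) _ _)
          (Continuous.intervalIntegrable (by fun_prop) _ _)]
      ring_nf
    simp_rw [inner, hG, ← intervalIntegral.integral_const_mul δ]
    rw [← intervalIntegral.integral_add (Continuous.intervalIntegrable (by fun_prop) _ _)
      (Continuous.intervalIntegrable (by fun_prop) _ _)]
    refine intervalIntegral.integral_congr fun x _ => ?_
    exact intervalIntegral.integral_add (Continuous.intervalIntegrable (by fun_prop) _ _)
      (Continuous.intervalIntegrable (by fun_prop) _ _)
  simp_rw [hF, ← hG0]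
  refine HasDerivAt.const_add _ ?_
  rw [hasDerivAt_iff_tendsto_slope]
  refine ((hGc.tendsto 0).mono_left nhdsWithin_le_nhds).congr' ?_
  filter_upwards [self_mem_nhdsWithin] with δ hδ
  have : δ ≠ 0 := hδ
  simp [slope, this]

end SphereIntegrals

/-- Exterior potential of a homogeneous body bounded by
`s = R(1 + δ P₂(cos α))`: for `0 < R < r`, the triple integral `F(δ)` of the
inverse distance satisfies `F(0) = 4πR³/(3r)` and
`F'(0) = (4π/5)(R⁵/r³) P₂(cos ψ)`; consequently the potential
`V_S(δ) = −(3κM/(4πR³)) F(δ)` satisfies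
`V_S = −κM(1/r + (3/5)(R²/r³) δ P₂(cos ψ)) + o(δ)`. -/
theorem exterior_potential_deformed_body
    (R r : ℝ) (hR : 0 < R) (hRr : R < r)
    (ψ : ℝ) (hψ : ψ ∈ Set.Icc (0 : ℝ) Real.pi)
    (P₂ : ℝ → ℝ) (hP₂ : ∀ z : ℝ, P₂ z = (3 * z ^ 2 - 1) / 2)
    (F : ℝ → ℝ)
    (hF : ∀ δ : ℝ, F δ =
      ∫ α in (0:ℝ)..Real.pi, ∫ φ in (0:ℝ)..(2 * Real.pi),
        ∫ s in (0:ℝ)..(R * (1 + δ * P₂ (Real.cos α))),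
          s ^ 2 * Real.sin α /
            Real.sqrt (r ^ 2 + s ^ 2 -
              2 * r * s * (Real.cos ψ * Real.cos α +
                Real.sin ψ * Real.sin α * Real.cos φ)))
    (κ M : ℝ) (hκ : 0 < κ) (hM : 0 < M)
    (VS : ℝ → ℝ)
    (hVS : ∀ δ : ℝ, VS δ = -(3 * κ * M / (4 * Real.pi * R ^ 3)) * F δ) :
    F 0 = 4 * Real.pi * R ^ 3 / (3 * r) ∧
      HasDerivAt F ((4 * Real.pi / 5) * (R ^ 5 / r ^ 3) * P₂ (Real.cos ψ)) 0 ∧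
      (fun δ : ℝ => VS δ -
          (-(κ * M) * (1 / r +
            (3 / 5) * (R ^ 2 / r ^ 3) * δ * P₂ (Real.cos ψ))))
        =o[nhds 0] fun δ : ℝ => δ := by
  simp only [hP₂] at hF ⊢
  clear hP₂
  have hr : 0 < r := hR.trans hRr
  obtain ⟨ρ, hRρ, hρr⟩ := exists_between hRr
  have hc : 0 < (r - ρ) ^ 2 := sq_pos_of_pos (sub_pos.2 hρr)
  let k : ℝ × ℝ × ℝ → ℝ := fun w => w.2.2 ^ 2 * Real.sin w.1 /
    √(max (r ^ 2 + w.2.2 ^ 2 - 2 * r * w.2.2 * (Real.cos ψ * Real.cos w.1 +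
      Real.sin ψ * Real.sin w.1 * Real.cos w.2.1)) ((r - ρ) ^ 2))
  have hk : Continuous k := by
    have (w : ℝ × ℝ × ℝ) : √(max (r ^ 2 + w.2.2 ^ 2 - 2 * r * w.2.2 *
        (Real.cos ψ * Real.cos w.1 + Real.sin ψ * Real.sin w.1 * Real.cos w.2.1))
          ((r - ρ) ^ 2)) ≠ 0 := (Real.sqrt_pos.2 (lt_max_of_lt_right hc)).ne'
    fun_prop (disch := assumption)
  have hkeq (a p : ℝ) {s : ℝ} (hs : 0 ≤ s) (hsρ : s ≤ ρ) : k (a, p, s) =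
      s ^ 2 * Real.sin a / √(r ^ 2 + s ^ 2 - 2 * r * s * (Real.cos ψ * Real.cos a +
        Real.sin ψ * Real.sin a * Real.cos p)) := by
    have h := sq_sub_le_sq_dist hr.le hs (cos_mul_cos_add_mem_Icc ψ a p).2
    simp only [k]
    rw [max_eq_left (le_trans (by gcongr) h)]
  have hFk : F =ᶠ[nhds 0] fun δ => ∫ a in (0 : ℝ)..Real.pi, ∫ p in (0 : ℝ)..(2 * Real.pi),
      ∫ s in 0..(R * (1 + δ * ((3 * Real.cos a ^ 2 - 1) / 2))), k (a, p, s) := by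
    filter_upwards [Icc_mem_nhds (by norm_num : (-1 : ℝ) < 0) one_pos,
      Icc_mem_nhds (neg_lt_zero.2 (div_pos (sub_pos.2 hRρ) hR)) (div_pos (sub_pos.2 hRρ) hR)]
      with δ h1 h2
    rw [hF]
    refine intervalIntegral.integral_congr fun a _ => intervalIntegral.integral_congr fun p _ =>
      intervalIntegral.integral_congr fun s hs => ?_
    have hP : |(3 * Real.cos a ^ 2 - 1) / 2| ≤ 1 :=
      abs_le.2 ⟨by nlinarith [sq_nonneg (Real.cos a)], by linarith [Real.cos_sq_le_one a]⟩
    have hδ (e : ℝ) (he : |δ| ≤ e) : |δ * ((3 * Real.cos a ^ 2 - 1) / 2)| ≤ e := by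
      rw [abs_mul]
      exact (mul_le_of_le_one_right (abs_nonneg _) hP).trans he
    have hlo := (abs_le.1 (hδ 1 (abs_le.2 h1))).1
    have hhi := (abs_le.1 (hδ _ (abs_le.2 h2))).2
    rw [le_div_iff₀ hR] at hhi
    rw [Set.uIcc_of_le (mul_nonneg hR.le (by linarith))] at hs
    exact (hkeq a p hs.1 (hs.2.trans (by linarith))).symm
  have hF0 : F 0 = 4 * Real.pi * R ^ 3 / (3 * r) := by
    rw [hFk.self_of_nhds]
    simp only [zero_mul, add_zero, mul_one]
    rw [intervalIntegral_rotate_of_continuous hk,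
      intervalIntegral.integral_congr (g := fun s => 4 * Real.pi / r * s ^ 2),
      intervalIntegral.integral_const_mul, integral_pow]
    · field_simp
      ring
    · intro s hs
      rw [Set.uIcc_of_le hR.le] at hs
      simp only [hkeq _ _ hs.1 (hs.2.trans hRρ.le)]
      obtain rfl | hs0 := hs.1.eq_or_lt
      · simp
      have h := sphere_integral_legendre_two_mul_inv_dist hs0 (hs.2.trans_lt hRr) 1 0 ψ
      calc _ = s ^ 2 * (4 * Real.pi * (1 / r + 0 * ((3 * Real.cos ψ ^ 2 - 1) / 2) *
              (s ^ 2 / (5 * r ^ 3)))) := by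
            simp_rw [← h, ← intervalIntegral.integral_const_mul]
            congr! 4
            ring
        _ = _ := by ring
  have hF' : HasDerivAt F ((4 * Real.pi / 5) * (R ^ 5 / r ^ 3) *
      ((3 * Real.cos ψ ^ 2 - 1) / 2)) 0 := by
    refine ((hasDerivAt_integral_radial hk (u := fun a => (3 * Real.cos a ^ 2 - 1) / 2)
      (by fun_prop) R 0 Real.pi 0 (2 * Real.pi)).congr_of_eventuallyEq hFk).congr_deriv ?_
    have h := sphere_integral_legendre_two_mul_inv_dist hR hRr 0 1 ψ
    simp only [hkeq _ _ hR.le hRρ.le]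
    calc _ = R ^ 3 * (4 * Real.pi * (0 / r + 1 * ((3 * Real.cos ψ ^ 2 - 1) / 2) *
            (R ^ 2 / (5 * r ^ 3)))) := by
          simp_rw [← h, ← intervalIntegral.integral_const_mul]
          congr! 4
          ring
      _ = _ := by
        field_simp
        ring
  refine ⟨hF0, hF', ?_⟩
  have h := (hasDerivAt_iff_isLittleO.1 hF').const_mul_left (-(3 * κ * M / (4 * Real.pi * R ^ 3)))
  refine h.congr (fun δ => ?_) fun δ => sub_zero δ
  rw [hVS, hF0, smul_eq_mul]
  have := Real.pi_pos
  field_simp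
  ring
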